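/- arXiv:2303.17674 — 3 statements merged into one kernel-verified Lean document; each statement's English description precedes it below -/
import Mathlib

section
/- Let n ≥ 1, x̄ ∈ ℝⁿ and δx̄ ∈ ℝⁿ with δx̄ᵢ > 0 for all i. For λ > 1 define h_λ(x) = ( Σᵢ |(xᵢ − x̄ᵢ)/δx̄ᵢ|^λ )^{2/λ}, and the sets C = {x ∈ ℝⁿ : |xᵢ − x̄ᵢ| ≤ δx̄ᵢ for all i}, Ĉ⁻_λ = {x ∈ ℝⁿ : h_λ(x) ≤ 1} and Ĉ⁺_λ = {x ∈ ℝⁿ : h_λ(x) ≤ n^{2/λ}}. Then d_H(Ĉ⁻_λ, C) → 0 and d_H(Ĉ⁺_λ, C) → 0 as λ → ∞; in other words, the smooth inner and outer approximations converge to the hyper-rectangle C in Hausdorff distance. -/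
open Set

noncomputable section

/-- If `S ⊆ T` and the homothety of ratio `c⁻¹ ≤ 1` centred at `a` maps `T` into `S`, then the
Hausdorff distance of `S` and `T` is at most `(c - 1) * R` for `R` bounding the distance from `a`
to the points of `S`. -/
theorem hausdorffDist_le_of_homothety {E : Type*} [NormedAddCommGroup E] [NormedSpace ℝ E]
    {S T : Set E} {a : E} {c R : ℝ} (hc : 1 ≤ c) (hR : 0 ≤ R) (hST : S ⊆ T)
    (hTS : ∀ x ∈ T, a + c⁻¹ • (x - a) ∈ S) (hS : ∀ x ∈ S, ‖x - a‖ ≤ R) :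
    Metric.hausdorffDist S T ≤ (c - 1) * R := by
  have hr : 0 ≤ (c - 1) * R := mul_nonneg (by linarith) hR
  refine Metric.hausdorffDist_le_of_mem_dist hr (fun x hx => ⟨x, hST hx, by simpa using hr⟩) ?_
  intro x hx
  refine ⟨_, hTS x hx, ?_⟩
  have hc0 : c ≠ 0 := by positivity
  have hdiff : x - (a + c⁻¹ • (x - a)) = (c - 1) • ((a + c⁻¹ • (x - a)) - a) := by
    rw [add_sub_cancel_left, smul_smul, sub_mul, mul_inv_cancel₀ hc0, sub_smul]
    module
  rw [dist_eq_norm, hdiff, norm_smul, Real.norm_of_nonneg (by linarith)]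
  exact mul_le_mul_of_nonneg_left (hS _ (hTS x hx)) (by linarith)

/-- Points of the box `|x i - a i| ≤ d i` lie within `‖d‖` of its centre `a`. -/
theorem EuclideanSpace.norm_sub_le_of_forall_abs_sub_le {ι : Type*} [Fintype ι]
    {x a d : EuclideanSpace ℝ ι} (h : ∀ i, |x i - a i| ≤ d i) : ‖x - a‖ ≤ ‖d‖ := by
  rw [EuclideanSpace.norm_eq, EuclideanSpace.norm_eq]
  refine Real.sqrt_le_sqrt (Finset.sum_le_sum fun i _ => ?_)
  refine pow_le_pow_left₀ (norm_nonneg _) ?_ 2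
  exact (h i).trans (le_abs_self _)

theorem tendsto_natCast_rpow_one_div_atTop {n : ℕ} (hn : 1 ≤ n) :
    Filter.Tendsto (fun lam : ℝ => (n : ℝ) ^ (1 / lam)) Filter.atTop (nhds 1) := by
  have h : Filter.Tendsto (fun lam : ℝ => 1 / lam) Filter.atTop (nhds 0) := by
    simpa using tendsto_inv_atTop_zero (𝕜 := ℝ)
  have hn0 : (n : ℝ) ≠ 0 := by positivity
  simpa using tendsto_const_nhds.rpow h (Or.inl hn0)

/-- the smooth inner and outer `λ`-relaxations of a hyper-rectangle `C`
converge to `C` in Hausdorff distance as `λ → ∞`. -/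
theorem box_lambda_relaxations_hausdorff_tendsto
    (n : ℕ) (hn : 1 ≤ n)
    (xbar δx : EuclideanSpace ℝ (Fin n)) (hδx : ∀ i, 0 < δx i) :
    Filter.Tendsto (fun lam : ℝ =>
        Metric.hausdorffDist
          {x : EuclideanSpace ℝ (Fin n) |
            (∑ i, |(x i - xbar i) / δx i| ^ lam) ^ (2 / lam) ≤ 1}
          {x : EuclideanSpace ℝ (Fin n) | ∀ i, |x i - xbar i| ≤ δx i})
      Filter.atTop (nhds 0) ∧
    Filter.Tendsto (fun lam : ℝ =>
        Metric.hausdorffDist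
          {x : EuclideanSpace ℝ (Fin n) |
            (∑ i, |(x i - xbar i) / δx i| ^ lam) ^ (2 / lam) ≤ (n : ℝ) ^ (2 / lam)}
          {x : EuclideanSpace ℝ (Fin n) | ∀ i, |x i - xbar i| ≤ δx i})
      Filter.atTop (nhds 0) := by
  have hn1 : (1 : ℝ) ≤ n := by exact_mod_cast hn
  have hlim : Filter.Tendsto (fun lam : ℝ => ((n : ℝ) ^ (1 / lam) - 1) * ‖δx‖)
      Filter.atTop (nhds 0) := by
    simpa using ((tendsto_natCast_rpow_one_div_atTop hn).sub_const 1).mul_const ‖δx‖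
  have hsum0 : ∀ (lam : ℝ) (x : EuclideanSpace ℝ (Fin n)),
      0 ≤ ∑ i, |(x i - xbar i) / δx i| ^ lam := fun lam x =>
    Finset.sum_nonneg fun i _ => Real.rpow_nonneg (abs_nonneg _) _
  have hterm : ∀ (lam : ℝ) (x : EuclideanSpace ℝ (Fin n)) (i : Fin n),
      |(x i - xbar i) / δx i| ^ lam ≤ ∑ i, |(x i - xbar i) / δx i| ^ lam := fun lam x i =>
    Finset.single_le_sum (f := fun i => |(x i - xbar i) / δx i| ^ lam)
      (fun i _ => Real.rpow_nonneg (abs_nonneg _) _) (Finset.mem_univ i)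
  have hratio : ∀ (x : EuclideanSpace ℝ (Fin n)) (i : Fin n),
      |(x i - xbar i) / δx i| ≤ 1 ↔ |x i - xbar i| ≤ δx i := fun x i => by
    rw [abs_div, abs_of_pos (hδx i), div_le_one (hδx i)]
  have hbox : ∀ {lam : ℝ}, 0 < lam → ∀ x : EuclideanSpace ℝ (Fin n),
      (∀ i, |x i - xbar i| ≤ δx i) → ∑ i, |(x i - xbar i) / δx i| ^ lam ≤ n := by
    intro lam hlam x hx
    calc ∑ i, |(x i - xbar i) / δx i| ^ lam ≤ ∑ _i : Fin n, (1 : ℝ) :=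
          Finset.sum_le_sum fun i _ =>
            Real.rpow_le_one (abs_nonneg _) ((hratio x i).2 (hx i)) hlam.le
      _ = n := by simp
  have hscale : ∀ (c : ℝ) (x : EuclideanSpace ℝ (Fin n)) (i : Fin n), 0 < c →
      |((xbar + c⁻¹ • (x - xbar)) i - xbar i) / δx i| = c⁻¹ * |(x i - xbar i) / δx i| := by
    intro c x i hc
    have : ((xbar + c⁻¹ • (x - xbar)) i - xbar i) / δx i = c⁻¹ * ((x i - xbar i) / δx i) := by
      simp [mul_div_assoc]
    rw [this, abs_mul, abs_of_pos (inv_pos.2 hc)]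
  have hpow : ∀ {lam : ℝ}, 0 < lam → ((n : ℝ) ^ (1 / lam)) ^ lam = n := by
    intro lam hlam
    rw [← Real.rpow_mul (by positivity), one_div_mul_cancel hlam.ne', Real.rpow_one]
  have hroot : ∀ {lam : ℝ}, 0 < lam → 1 ≤ (n : ℝ) ^ (1 / lam) := fun hlam =>
    Real.one_le_rpow hn1 (by positivity)
  refine ⟨squeeze_zero' (Filter.Eventually.of_forall fun _ => Metric.hausdorffDist_nonneg) ?_ hlim,
    squeeze_zero' (Filter.Eventually.of_forall fun _ => Metric.hausdorffDist_nonneg) ?_ hlim⟩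
  · filter_upwards [Filter.eventually_gt_atTop 0] with lam hlam
    have hc := hroot hlam
    have hc0 : 0 < (n : ℝ) ^ (1 / lam) := by linarith
    have hmem : ∀ x : EuclideanSpace ℝ (Fin n),
        (∑ i, |(x i - xbar i) / δx i| ^ lam) ^ (2 / lam) ≤ 1 ↔
          ∑ i, |(x i - xbar i) / δx i| ^ lam ≤ 1 := fun x => by
      conv_lhs => rw [← Real.one_rpow (2 / lam)]
      exact Real.rpow_le_rpow_iff (hsum0 lam x) zero_le_one (by positivity)
    have hsub : ∀ x : EuclideanSpace ℝ (Fin n),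
        (∑ i, |(x i - xbar i) / δx i| ^ lam) ^ (2 / lam) ≤ 1 →
          ∀ i, |x i - xbar i| ≤ δx i := fun x hx i => by
      rw [← hratio, ← Real.rpow_le_rpow_iff (abs_nonneg _) zero_le_one hlam, Real.one_rpow]
      exact (hterm lam x i).trans ((hmem x).1 hx)
    refine hausdorffDist_le_of_homothety (a := xbar) hc (norm_nonneg _) hsub ?_
      fun x hx => EuclideanSpace.norm_sub_le_of_forall_abs_sub_le (hsub x hx)
    intro x hx
    rw [mem_ofPred_eq, hmem]
    simp_rw [hscale _ x _ hc0, Real.mul_rpow (inv_pos.2 hc0).le (abs_nonneg _),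
      Real.inv_rpow hc0.le, hpow hlam]
    rw [← Finset.mul_sum, inv_mul_le_one₀ (by linarith)]
    exact hbox hlam x hx
  · filter_upwards [Filter.eventually_gt_atTop 0] with lam hlam
    have hc := hroot hlam
    have hc0 : 0 < (n : ℝ) ^ (1 / lam) := by linarith
    rw [Metric.hausdorffDist_comm]
    refine hausdorffDist_le_of_homothety (a := xbar) hc (norm_nonneg _) ?_ ?_
      fun x hx => EuclideanSpace.norm_sub_le_of_forall_abs_sub_le hx
    · exact fun x hx => Real.rpow_le_rpow (hsum0 lam x) (hbox hlam x hx) (by positivity)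
    · intro x hx i
      rw [mem_ofPred_eq,
        Real.rpow_le_rpow_iff (hsum0 lam x) (by positivity) (by positivity)] at hx
      rw [← hratio, hscale _ x i hc0, inv_mul_le_one₀ hc0,
        ← Real.rpow_le_rpow_iff (abs_nonneg _) hc0.le hlam, hpow hlam]
      exact (hterm lam x i).trans hx
end
end

section
/- Let n ≥ 1, x̄ ∈ ℝⁿ, δx̄ ∈ ℝⁿ with δx̄ᵢ > 0 for all i, and λ > 1. Define h_λ(x) = ( Σᵢ |(xᵢ − x̄ᵢ)/δx̄ᵢ|^λ )^{2/λ} and the boundary M_λ = {x ∈ ℝⁿ : h_λ(x) = 1}. Define n_λ : M_λ → ℝⁿ by n_λ(x) = v(x)/‖v(x)‖ where v(x)ᵢ = sign(xᵢ − x̄ᵢ)|xᵢ − x̄ᵢ|^{λ−1} δx̄ᵢ^{−λ}, and m_λ : S^{n−1} → ℝⁿ by m_λ(d) = x̄ + u(d)/( Σⱼ |dⱼ δx̄ⱼ|^{λ/(λ−1)} )^{1/λ} where u(d)ᵢ = sign(dᵢ)|dᵢ|^{1/(λ−1)} δx̄ᵢ^{λ/(λ−1)}. Then: (i) for every x ∈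 M_λ, n_λ(x) is a well-defined unit vector and m_λ(n_λ(x)) = x; (ii) for every d ∈ S^{n−1}, h_λ(m_λ(d)) = 1 and n_λ(m_λ(d)) = d. In particular, n_λ is a bijection from M_λ onto S^{n−1} with inverse m_λ (it is the Gauss map of M_λ). -/
open Set

noncomputable section

/-- The gradient-direction (Gauss map) `n_λ` of the `λ`-relaxed box boundary:
`n_λ(x) = v(x)/‖v(x)‖` where `v(x)ᵢ = sign(xᵢ - x̄ᵢ)|xᵢ - x̄ᵢ|^{λ-1} δx̄ᵢ^{-λ}`. -/
def boxGauss {n : ℕ} (xbar δx : EuclideanSpace ℝ (Fin n)) (lam : ℝ)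
    (x : EuclideanSpace ℝ (Fin n)) : EuclideanSpace ℝ (Fin n) :=
  ‖(EuclideanSpace.equiv (Fin n) ℝ).symm (fun i =>
      Real.sign (x i - xbar i) * |x i - xbar i| ^ (lam - 1) * (δx i) ^ (-lam))‖⁻¹ •
    (EuclideanSpace.equiv (Fin n) ℝ).symm (fun i =>
      Real.sign (x i - xbar i) * |x i - xbar i| ^ (lam - 1) * (δx i) ^ (-lam))

/-- The inverse Gauss map `m_λ` of the `λ`-relaxed box boundary:
`m_λ(d) = x̄ + u(d)/(Σⱼ |dⱼ δx̄ⱼ|^{λ/(λ-1)})^{1/λ}` where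
`u(d)ᵢ = sign(dᵢ)|dᵢ|^{1/(λ-1)} δx̄ᵢ^{λ/(λ-1)}`. -/
def boxGaussInv {n : ℕ} (xbar δx : EuclideanSpace ℝ (Fin n)) (lam : ℝ)
    (d : EuclideanSpace ℝ (Fin n)) : EuclideanSpace ℝ (Fin n) :=
  xbar + (EuclideanSpace.equiv (Fin n) ℝ).symm (fun i =>
    Real.sign (d i) * |d i| ^ (1 / (lam - 1)) * (δx i) ^ (lam / (lam - 1)) /
      (∑ j, |d j * δx j| ^ (lam / (lam - 1))) ^ (1 / lam))

/-- The odd extension of `r ↦ r ^ a` to the real line. -/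
def signPow (a r : ℝ) : ℝ := Real.sign r * |r| ^ a

lemma abs_signPow {a : ℝ} (ha : a ≠ 0) (r : ℝ) : |signPow a r| = |r| ^ a := by
  rcases lt_trichotomy r 0 with h | rfl | h
  · simp [signPow, Real.sign_of_neg h, abs_of_nonneg (Real.rpow_nonneg (abs_nonneg r) a)]
  · simp [signPow, Real.zero_rpow ha]
  · simp [signPow, Real.sign_of_pos h, abs_of_nonneg (Real.rpow_nonneg (abs_nonneg r) a)]

lemma sign_signPow (a r : ℝ) : Real.sign (signPow a r) = Real.sign r := by
  rcases lt_trichotomy r 0 with h | rfl | h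
  · have := Real.rpow_pos_of_pos (abs_pos.mpr h.ne) a
    rw [Real.sign_of_neg h, Real.sign_of_neg]
    simpa [signPow, Real.sign_of_neg h] using this
  · simp [signPow]
  · have := Real.rpow_pos_of_pos (abs_pos.mpr h.ne') a
    rw [Real.sign_of_pos h, Real.sign_of_pos]
    simpa [signPow, Real.sign_of_pos h] using this

lemma signPow_signPow {a : ℝ} (ha : a ≠ 0) (b r : ℝ) :
    signPow b (signPow a r) = signPow (a * b) r := by
  rw [signPow, sign_signPow, abs_signPow ha, ← Real.rpow_mul (abs_nonneg r), signPow]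

lemma signPow_one (r : ℝ) : signPow 1 r = r := by
  rcases lt_trichotomy r 0 with h | rfl | h
  · simp [signPow, Real.sign_of_neg h, abs_of_neg h]
  · simp [signPow]
  · simp [signPow, Real.sign_of_pos h, abs_of_pos h]

lemma signPow_mul_of_pos (a r : ℝ) {c : ℝ} (hc : 0 < c) :
    signPow a (r * c) = signPow a r * c ^ a := by
  have h : Real.sign (r * c) = Real.sign r := by
    rcases lt_trichotomy r 0 with h | rfl | h
    · rw [Real.sign_of_neg h, Real.sign_of_neg (mul_neg_of_neg_of_pos h hc)]
    · simp
    · rw [Real.sign_of_pos h, Real.sign_of_pos (mul_pos h hc)]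
  rw [signPow, h, abs_mul, abs_of_pos hc, Real.mul_rpow (abs_nonneg r) hc.le, signPow, mul_assoc]

lemma signPow_eq_zero {a r : ℝ} (ha : a ≠ 0) (h : signPow a r = 0) : r = 0 := by
  have := abs_signPow ha r
  rw [h, abs_zero] at this
  exact abs_eq_zero.mp ((Real.rpow_eq_zero (abs_nonneg r) ha).mp this.symm)

/-- The vector `v(x)` whose normalization is the Gauss map. -/
def boxNormal {n : ℕ} (xbar δx : EuclideanSpace ℝ (Fin n)) (lam : ℝ)
    (x : EuclideanSpace ℝ (Fin n)) : EuclideanSpace ℝ (Fin n) :=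
  (EuclideanSpace.equiv (Fin n) ℝ).symm
    (fun i => signPow (lam - 1) (x i - xbar i) * (δx i) ^ (-lam))

lemma boxNormal_apply {n : ℕ} (xbar δx : EuclideanSpace ℝ (Fin n)) (lam : ℝ)
    (x : EuclideanSpace ℝ (Fin n)) (i : Fin n) :
    boxNormal xbar δx lam x i = signPow (lam - 1) (x i - xbar i) * (δx i) ^ (-lam) := rfl

lemma boxGauss_eq {n : ℕ} (xbar δx : EuclideanSpace ℝ (Fin n)) (lam : ℝ)
    (x : EuclideanSpace ℝ (Fin n)) :
    boxGauss xbar δx lam x = ‖boxNormal xbar δx lam x‖⁻¹ • boxNormal xbar δx lam x := rfl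

lemma boxGaussInv_apply {n : ℕ} (xbar δx : EuclideanSpace ℝ (Fin n)) (lam : ℝ)
    (d : EuclideanSpace ℝ (Fin n)) (i : Fin n) :
    boxGaussInv xbar δx lam d i = xbar i + signPow (1 / (lam - 1)) (d i) *
      (δx i) ^ (lam / (lam - 1)) / (∑ j, |d j * δx j| ^ (lam / (lam - 1))) ^ (1 / lam) := rfl

lemma boxNormal_ne_zero {n : ℕ} {xbar δx : EuclideanSpace ℝ (Fin n)} (hδx : ∀ i, 0 < δx i)
    {lam : ℝ} (hlam : 1 < lam) {x : EuclideanSpace ℝ (Fin n)}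
    (hx : ∑ i, |(x i - xbar i) / δx i| ^ lam = 1) : boxNormal xbar δx lam x ≠ 0 := by
  intro h
  have hz : ∀ i, x i - xbar i = 0 := fun i => by
    have hi : boxNormal xbar δx lam x i = 0 := by simp [h]
    rw [boxNormal_apply] at hi
    exact signPow_eq_zero (by linarith)
      ((mul_eq_zero.mp hi).resolve_right (Real.rpow_pos_of_pos (hδx i) _).ne')
  have h0 : lam ≠ 0 := by linarith
  simp [hz, Real.zero_rpow h0] at hx

lemma boxGaussInv_boxGauss {n : ℕ} {xbar δx : EuclideanSpace ℝ (Fin n)} (hδx : ∀ i, 0 < δx i)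
    {lam : ℝ} (hlam : 1 < lam) {x : EuclideanSpace ℝ (Fin n)}
    (hx : ∑ i, |(x i - xbar i) / δx i| ^ lam = 1) :
    boxGaussInv xbar δx lam (boxGauss xbar δx lam x) = x := by
  have hl : lam - 1 ≠ 0 := by linarith
  have hl0 : lam ≠ 0 := by linarith
  set c := ‖boxNormal xbar δx lam x‖⁻¹ with hc
  have hcpos : 0 < c := inv_pos.mpr (norm_pos_iff.mpr (boxNormal_ne_zero hδx hlam hx))
  have hd : ∀ i, boxGauss xbar δx lam x i =
      signPow (lam - 1) (x i - xbar i) * ((δx i) ^ (-lam) * c) := fun i => by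
    rw [boxGauss_eq, PiLp.smul_apply, boxNormal_apply, smul_eq_mul, ← hc]; ring
  have hsum : ∑ j, |boxGauss xbar δx lam x j * δx j| ^ (lam / (lam - 1)) =
      c ^ (lam / (lam - 1)) := by
    have : ∀ j, |boxGauss xbar δx lam x j * δx j| ^ (lam / (lam - 1)) =
        |(x j - xbar j) / δx j| ^ lam * c ^ (lam / (lam - 1)) := fun j => by
      have hj := hδx j
      have hp := Real.rpow_pos_of_pos hj (-lam)
      rw [hd, abs_mul, abs_mul, abs_signPow hl, abs_of_pos hj, abs_of_pos (mul_pos hp hcpos),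
        show ∀ a b : ℝ, a * (b * c) * δx j = a * (b * δx j) * c by intros; ring,
        ← Real.rpow_add_one hj.ne', Real.mul_rpow (by positivity) hcpos.le,
        Real.mul_rpow (by positivity) (by positivity), ← Real.rpow_mul (abs_nonneg _),
        ← Real.rpow_mul hj.le, abs_div, abs_of_pos hj, Real.div_rpow (abs_nonneg _) hj.le,
        mul_div_cancel₀ _ hl, div_eq_mul_inv (_ ^ lam), ← Real.rpow_neg hj.le]
      congr 3
      field_simp
      ring
    rw [Finset.sum_congr rfl fun j _ => this j, ← Finset.sum_mul, hx, one_mul]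
  ext i
  have hi := hδx i
  have hp := Real.rpow_pos_of_pos hi (-lam)
  rw [boxGaussInv_apply, hsum, hd, signPow_mul_of_pos _ _ (mul_pos hp hcpos), signPow_signPow hl,
    mul_one_div_cancel hl, signPow_one, Real.mul_rpow hp.le hcpos.le, ← Real.rpow_mul hi.le,
    ← Real.rpow_mul hcpos.le]
  have h1 : δx i ^ (-lam * (1 / (lam - 1))) * δx i ^ (lam / (lam - 1)) = 1 := by
    rw [← Real.rpow_add hi, show -lam * (1 / (lam - 1)) + lam / (lam - 1) = 0 by ring,
      Real.rpow_zero]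
  have h2 : lam / (lam - 1) * (1 / lam) = 1 / (lam - 1) := by field_simp
  have h3 := (Real.rpow_pos_of_pos hcpos (1 / (lam - 1))).ne'
  rw [h2, show ∀ y a b e : ℝ, y * (a * b) * e / b = y * (a * e) * (b / b) by intros; ring, h1,
    div_self h3]
  ring

lemma sum_abs_rpow_pos {n : ℕ} {δx : EuclideanSpace ℝ (Fin n)} (hδx : ∀ i, 0 < δx i) (q : ℝ)
    {d : EuclideanSpace ℝ (Fin n)} (hd : d ≠ 0) : 0 < ∑ j, |d j * δx j| ^ q := by
  obtain ⟨i, hi⟩ : ∃ i, d i ≠ 0 := by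
    by_contra! h
    exact hd (by ext i; simp [h i])
  exact Finset.sum_pos' (fun j _ => Real.rpow_nonneg (abs_nonneg _) _)
    ⟨i, Finset.mem_univ i, Real.rpow_pos_of_pos (abs_pos.mpr (mul_ne_zero hi (hδx i).ne')) _⟩

lemma sum_boxGaussInv {n : ℕ} (xbar : EuclideanSpace ℝ (Fin n)) {δx : EuclideanSpace ℝ (Fin n)}
    (hδx : ∀ i, 0 < δx i) {lam : ℝ} (hlam : 1 < lam) {d : EuclideanSpace ℝ (Fin n)} (hd : d ≠ 0) :
    ∑ i, |(boxGaussInv xbar δx lam d i - xbar i) / δx i| ^ lam = 1 := by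
  have hl : lam - 1 ≠ 0 := by linarith
  have hl0 : lam ≠ 0 := by linarith
  have hS := sum_abs_rpow_pos hδx (lam / (lam - 1)) hd
  set S := ∑ j, |d j * δx j| ^ (lam / (lam - 1)) with hSdef
  have hSp := Real.rpow_pos_of_pos hS (1 / lam)
  have : ∀ i, |(boxGaussInv xbar δx lam d i - xbar i) / δx i| ^ lam =
      |d i * δx i| ^ (lam / (lam - 1)) / S := fun i => by
    have hi := hδx i
    have hp := Real.rpow_pos_of_pos hi (lam / (lam - 1))
    rw [boxGaussInv_apply, ← hSdef, add_sub_cancel_left, div_right_comm, mul_div_assoc,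
      ← Real.rpow_sub_one hi.ne', abs_div, abs_mul, abs_signPow (one_div_ne_zero hl),
      abs_of_pos hSp, abs_of_pos (Real.rpow_pos_of_pos hi _),
      Real.div_rpow (by positivity) hSp.le, Real.mul_rpow (by positivity) (by positivity),
      ← Real.rpow_mul (abs_nonneg _), ← Real.rpow_mul hi.le, ← Real.rpow_mul hS.le,
      one_div_mul_cancel hl0, Real.rpow_one, abs_mul, abs_of_pos hi,
      Real.mul_rpow (abs_nonneg _) hi.le]
    congr 3
    · ring
    · field_simp
      ring
  rw [Finset.sum_congr rfl fun i _ => this i, ← Finset.sum_div, ← hSdef, div_self hS.ne']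

lemma boxGauss_boxGaussInv {n : ℕ} (xbar : EuclideanSpace ℝ (Fin n))
    {δx : EuclideanSpace ℝ (Fin n)} (hδx : ∀ i, 0 < δx i) {lam : ℝ} (hlam : 1 < lam)
    {d : EuclideanSpace ℝ (Fin n)} (hd : ‖d‖ = 1) :
    boxGauss xbar δx lam (boxGaussInv xbar δx lam d) = d := by
  have hl : lam - 1 ≠ 0 := by linarith
  have hS := sum_abs_rpow_pos hδx (lam / (lam - 1)) (norm_ne_zero_iff.mp (by simp [hd]) : d ≠ 0)
  set S := ∑ j, |d j * δx j| ^ (lam / (lam - 1)) with hSdef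
  have hSp := Real.rpow_pos_of_pos hS (1 / lam)
  set c := (S ^ (1 / lam))⁻¹ ^ (lam - 1) with hc
  have hcpos : 0 < c := Real.rpow_pos_of_pos (inv_pos.mpr hSp) _
  have hv : boxNormal xbar δx lam (boxGaussInv xbar δx lam d) = c • d := by
    ext i
    have hi := hδx i
    have hp := Real.rpow_pos_of_pos hi (lam / (lam - 1))
    rw [boxNormal_apply, boxGaussInv_apply, ← hSdef, add_sub_cancel_left, div_eq_mul_inv,
      mul_assoc, signPow_mul_of_pos _ _ (mul_pos hp (inv_pos.mpr hSp)),
      signPow_signPow (one_div_ne_zero hl), one_div_mul_cancel hl, signPow_one,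
      Real.mul_rpow hp.le (inv_pos.mpr hSp).le, ← hc, ← Real.rpow_mul hi.le,
      div_mul_cancel₀ _ hl, Real.rpow_neg hi.le, PiLp.smul_apply, smul_eq_mul]
    have := (Real.rpow_pos_of_pos hi lam).ne'
    field_simp
  rw [boxGauss_eq, hv, norm_smul, hd, mul_one, Real.norm_of_nonneg hcpos.le, smul_smul,
    inv_mul_cancel₀ hcpos.ne', one_smul]

/-- on the level set `M_λ = {h_λ = 1}` of
`h_λ(x) = (Σᵢ |(xᵢ-x̄ᵢ)/δx̄ᵢ|^λ)^{2/λ}`, the Gauss map `n_λ` is a well-defined unit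
vector field, and `m_λ` is its two-sided inverse: `m_λ ∘ n_λ = id` on `M_λ`, while for
every unit vector `d`, `m_λ(d) ∈ M_λ` and `n_λ(m_λ(d)) = d`. -/
theorem box_gauss_map_bijective
    (n : ℕ) (hn : 1 ≤ n)
    (xbar δx : EuclideanSpace ℝ (Fin n)) (hδx : ∀ i, 0 < δx i)
    (lam : ℝ) (hlam : 1 < lam) :
    (∀ x : EuclideanSpace ℝ (Fin n),
      (∑ i, |(x i - xbar i) / δx i| ^ lam) ^ (2 / lam) = 1 →
        ‖boxGauss xbar δx lam x‖ = 1 ∧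
        boxGaussInv xbar δx lam (boxGauss xbar δx lam x) = x) ∧
    ∀ d : EuclideanSpace ℝ (Fin n), ‖d‖ = 1 →
      (∑ i, |(boxGaussInv xbar δx lam d i - xbar i) / δx i| ^ lam) ^ (2 / lam) = 1 ∧
      boxGauss xbar δx lam (boxGaussInv xbar δx lam d) = d := by
  have h2 : 2 / lam ≠ 0 := div_ne_zero two_ne_zero (by linarith)
  refine ⟨fun x hx => ?_, fun d hd => ⟨?_, boxGauss_boxGaussInv xbar hδx hlam hd⟩⟩
  · have hx1 : ∑ i, |(x i - xbar i) / δx i| ^ lam = 1 :=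
      (Real.rpow_left_inj (Finset.sum_nonneg fun i _ => Real.rpow_nonneg (abs_nonneg _) _)
        zero_le_one h2).mp (by rw [hx, Real.one_rpow])
    refine ⟨?_, boxGaussInv_boxGauss hδx hlam hx1⟩
    rw [boxGauss_eq, norm_smul, norm_inv, norm_norm]
    exact inv_mul_cancel₀ (norm_ne_zero_iff.mpr (boxNormal_ne_zero hδx hlam hx1))
  · rw [sum_boxGaussInv xbar hδx hlam (norm_ne_zero_iff.mp (by simp [hd])), Real.one_rpow]
end
end

section
/- Let K ⊆ ℝⁿ be compact, let h : ℝⁿ → ℝ and h_λ : ℝⁿ → ℝ (for λ > 0) be continuous, and define the sublevel sets C = {x ∈ K : h(x) ≤ 0} and C_λ = {x ∈ K : h_λ(x) ≤ 0}. Assume C is nonempty, that sup_{x∈K} |h_λ(x) − h(x)| → 0 as λ → ∞, and that for every x ∈ C and every ε > 0 there exists z ∈ C with ‖x − z‖ ≤ ε and h(z) < 0. Then C_λ is nonempty for all sufficiently large λ and d_H(C_λ, C) → 0 as λ → ∞. -/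
open Set

noncomputable section

/-- On a compact set, points of small sublevel sets are close to the zero sublevel set. -/
theorem IsCompact.exists_pos_forall_le_exists_dist_lt {α : Type*} [PseudoMetricSpace α]
    {K : Set α} (hK : IsCompact K) {h : α → ℝ} (hh : ContinuousOn h K) {ε : ℝ} (hε : 0 < ε) :
    ∃ η > 0, ∀ x ∈ K, h x ≤ η → ∃ y ∈ {y ∈ K | h y ≤ 0}, dist x y < ε := by
  suffices H : ∃ η > 0, ∀ x ∈ K, x ∈ K → h x ≤ η → ∃ y ∈ {y ∈ K | h y ≤ 0}, dist x y < ε by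
    obtain ⟨η, hη, H⟩ := H
    exact ⟨η, hη, fun x hx => H x hx hx⟩
  refine hK.induction_on (p := fun s => ∃ η > 0, ∀ x ∈ s, x ∈ K → h x ≤ η →
    ∃ y ∈ {y ∈ K | h y ≤ 0}, dist x y < ε) ⟨1, one_pos, by simp⟩ ?_ ?_ ?_
  · rintro s t hst ⟨η, hη, H⟩
    exact ⟨η, hη, fun x hx => H x (hst hx)⟩
  · rintro s t ⟨η, hη, H⟩ ⟨θ, hθ, H'⟩
    refine ⟨min η θ, lt_min hη hθ, ?_⟩
    rintro x (hx | hx) hxK hxη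
    · exact H x hx hxK (hxη.trans (min_le_left _ _))
    · exact H' x hx hxK (hxη.trans (min_le_right _ _))
  · intro x hx
    rcases le_or_gt (h x) 0 with hx0 | hx0
    · exact ⟨Metric.ball x ε, mem_nhdsWithin_of_mem_nhds (Metric.ball_mem_nhds x hε),
        1, one_pos, fun y hy _ _ => ⟨x, ⟨hx, hx0⟩, hy⟩⟩
    · exact ⟨{y | h x / 2 < h y}, (hh x hx).eventually (lt_mem_nhds (half_lt_self hx0)),
        h x / 2, half_pos hx0, fun y hy _ hy' => absurd hy (not_lt.2 hy')⟩

/-- If every point of a compact set `C` can be approximated by points of `K` where `h` is negative,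
then `h` can be taken uniformly negative at a given approximation scale. -/
theorem IsCompact.exists_pos_forall_exists_le_neg_dist_lt {α : Type*} [PseudoMetricSpace α]
    {C K : Set α} (hC : IsCompact C) {h : α → ℝ}
    (hCK : ∀ x ∈ C, ∀ ε > 0, ∃ z ∈ K, h z < 0 ∧ dist x z ≤ ε) {ε : ℝ} (hε : 0 < ε) :
    ∃ η > 0, ∀ x ∈ C, ∃ z ∈ K, h z ≤ -η ∧ dist x z < ε := by
  refine hC.induction_on (p := fun s => ∃ η > 0, ∀ x ∈ s, ∃ z ∈ K, h z ≤ -η ∧ dist x z < ε)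
    ⟨1, one_pos, by simp⟩ ?_ ?_ ?_
  · rintro s t hst ⟨η, hη, H⟩
    exact ⟨η, hη, fun x hx => H x (hst hx)⟩
  · rintro s t ⟨η, hη, H⟩ ⟨θ, hθ, H'⟩
    refine ⟨min η θ, lt_min hη hθ, ?_⟩
    rintro x (hx | hx)
    · obtain ⟨z, hz, hz', hd⟩ := H x hx
      exact ⟨z, hz, hz'.trans (neg_le_neg (min_le_left _ _)), hd⟩
    · obtain ⟨z, hz, hz', hd⟩ := H' x hx
      exact ⟨z, hz, hz'.trans (neg_le_neg (min_le_right _ _)), hd⟩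
  · intro x hx
    obtain ⟨z, hz, hz0, hd⟩ := hCK x hx (ε / 2) (half_pos hε)
    refine ⟨Metric.ball x (ε / 2),
      mem_nhdsWithin_of_mem_nhds (Metric.ball_mem_nhds x (half_pos hε)),
      -h z, neg_pos.2 hz0, fun y hy => ⟨z, hz, (neg_neg (h z)).ge, ?_⟩⟩
    linarith [dist_triangle y x z, Metric.mem_ball.1 hy]

/-- Hausdorff convergence of sublevel sets: if `h_λ → h` uniformly on
the compact set `K` and every point of `C = {x ∈ K : h x ≤ 0}` is approximated by
interior points (`h < 0`), then the sublevel sets `C_λ = {x ∈ K : h_λ x ≤ 0}` are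
eventually nonempty and converge to `C` in Hausdorff distance as `λ → ∞`. -/
theorem sublevel_sets_hausdorff_tendsto
    (n : ℕ) (K : Set (EuclideanSpace ℝ (Fin n))) (hK : IsCompact K)
    (h : EuclideanSpace ℝ (Fin n) → ℝ) (hcont : Continuous h)
    (hfam : ℝ → EuclideanSpace ℝ (Fin n) → ℝ)
    (hfamcont : ∀ lam > (0:ℝ), Continuous (hfam lam))
    (hCne : ({x ∈ K | h x ≤ 0}).Nonempty)
    (hunif : ∀ η > (0:ℝ), ∃ Λ : ℝ, ∀ lam ≥ Λ, ∀ x ∈ K, |hfam lam x - h x| ≤ η)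
    (hint : ∀ x ∈ {x ∈ K | h x ≤ 0}, ∀ ε > (0:ℝ),
      ∃ z ∈ K, h z < 0 ∧ ‖x - z‖ ≤ ε) :
    (∀ᶠ lam in Filter.atTop, ({x ∈ K | hfam lam x ≤ 0}).Nonempty) ∧
    Filter.Tendsto (fun lam =>
        Metric.hausdorffDist {x ∈ K | hfam lam x ≤ 0} {x ∈ K | h x ≤ 0})
      Filter.atTop (nhds 0) := by
  have hC : IsCompact {x ∈ K | h x ≤ 0} :=
    hK.inter_right (isClosed_le hcont continuous_const)
  have key : ∀ ε > 0, ∀ᶠ lam in Filter.atTop,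
      (∀ x ∈ {x ∈ K | hfam lam x ≤ 0}, ∃ y ∈ {x ∈ K | h x ≤ 0}, dist x y < ε) ∧
      ∀ x ∈ {x ∈ K | h x ≤ 0}, ∃ y ∈ {x ∈ K | hfam lam x ≤ 0}, dist x y < ε := by
    intro ε hε
    obtain ⟨η, hη, H⟩ := hK.exists_pos_forall_le_exists_dist_lt hcont.continuousOn hε
    obtain ⟨θ, hθ, H'⟩ := hC.exists_pos_forall_exists_le_neg_dist_lt
      (by simpa only [dist_eq_norm] using hint) hε
    obtain ⟨Λ, hΛ⟩ := hunif (min η θ) (lt_min hη hθ)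
    filter_upwards [Filter.eventually_ge_atTop Λ] with lam hlam
    refine ⟨fun x hx => H x hx.1 ?_, fun x hx => ?_⟩
    · linarith [(abs_le.1 (hΛ lam hlam x hx.1)).1, min_le_left η θ, hx.2]
    · obtain ⟨z, hz, hz', hd⟩ := H' x hx
      refine ⟨z, ⟨hz, ?_⟩, hd⟩
      linarith [(abs_le.1 (hΛ lam hlam z hz)).2, min_le_right η θ]
  refine ⟨?_, ?_⟩
  · obtain ⟨x, hx⟩ := hCne
    filter_upwards [key 1 one_pos] with lam hlam
    obtain ⟨y, hy, -⟩ := hlam.2 x hx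
    exact ⟨y, hy⟩
  · rw [Metric.tendsto_nhds]
    intro ε hε
    filter_upwards [key (ε / 2) (half_pos hε)] with lam hlam
    rw [Real.dist_0_eq_abs, abs_of_nonneg Metric.hausdorffDist_nonneg]
    refine (Metric.hausdorffDist_le_of_mem_dist (half_pos hε).le (fun x hx => ?_)
      fun x hx => ?_).trans_lt (half_lt_self hε)
    · obtain ⟨y, hy, hd⟩ := hlam.1 x hx
      exact ⟨y, hy, hd.le⟩
    · obtain ⟨y, hy, hd⟩ := hlam.2 x hx
      exact ⟨y, hy, hd.le⟩
end
end
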